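/- arXiv:2601.12590 — 2 statements merged into one kernel-verified Lean document; each statement's English description precedes it below -/
import Mathlib

section
/- Let a, b be real numbers with 0 < a < b. Then ∫₀^∞ Bi(a x) Ai(a x) Ai²(b x) dx = (1/(12π²√(ab))) · arctan( √(3ab) / (b − a) ). -/
open MeasureTheory Real

noncomputable def besselK (ν x : ℝ) : ℝ :=
  ∫ t in Set.Ioi (0:ℝ), Real.exp (-x * Real.cosh t) * Real.cosh (ν * t)
noncomputable def besselI (ν x : ℝ) : ℝ :=
  ∑' k : ℕ, (1 / ((k.factorial : ℝ) * Real.Gamma ((k : ℝ) + ν + 1))) * (x / 2) ^ (2 * (k : ℝ) + ν)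
noncomputable def airyAi (x : ℝ) : ℝ :=
  (1 / Real.pi) * Real.sqrt (x / 3) * besselK (1 / 3) ((2 / 3) * x ^ ((3 : ℝ) / 2))

noncomputable def airyBi (x : ℝ) : ℝ :=
  Real.sqrt (x / 3) * (besselI (1 / 3) ((2 / 3) * x ^ ((3 : ℝ) / 2))
    + besselI (-(1 / 3)) ((2 / 3) * x ^ ((3 : ℝ) / 2)))

/-- The regularized confluent hypergeometric limit function `₀F₁(; c; z) / Γ(c)`. -/
noncomputable def hypLimit (c z : ℝ) : ℝ :=
  ∑' k : ℕ, z ^ k / ((k.factorial : ℝ) * Gamma (k + c))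

theorem factorial_two_mul_mul_Gamma_le {c : ℝ} (hc : 1 / 3 ≤ c) (k : ℕ) :
    ((2 * k).factorial : ℝ) * Gamma c ≤ 9 ^ k * (k.factorial * Gamma (k + c)) := by
  induction k with
  | zero => simp
  | succ k ih =>
    have h1 : Gamma (((k + 1 : ℕ) : ℝ) + c) = (k + c) * Gamma (k + c) := by
      rw [← Gamma_add_one (by positivity)]
      congr 1
      push_cast
      ring
    have h2 : ((2 * (k + 1)).factorial : ℝ) = (2 * k + 2) * (2 * k + 1) * (2 * k).factorial := by
      rw [show 2 * (k + 1) = 2 * k + 1 + 1 by ring, Nat.factorial_succ, Nat.factorial_succ]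
      push_cast
      ring
    have h3 : ((k + 1).factorial : ℝ) = (k + 1) * k.factorial := by
      rw [Nat.factorial_succ]
      push_cast
      ring
    have h4 : (2 * (k : ℝ) + 2) * (2 * k + 1) ≤ 9 * (k + 1) * (k + c) := by
      have : (0 : ℝ) ≤ k := k.cast_nonneg
      nlinarith
    have h5 : 0 ≤ Gamma c := (Gamma_pos_of_pos (by linarith)).le
    rw [h1, h2, h3]
    calc (2 * (k : ℝ) + 2) * (2 * k + 1) * (2 * k).factorial * Gamma c
        = (2 * (k : ℝ) + 2) * (2 * k + 1) * ((2 * k).factorial * Gamma c) := by ring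
      _ ≤ 9 * (k + 1) * (k + c) * (9 ^ k * (k.factorial * Gamma (k + c))) := by gcongr
      _ = _ := by ring

theorem hypLimit_term_le {c : ℝ} (hc : 1 / 3 ≤ c) (z : ℝ) (k : ℕ) :
    |z ^ k / ((k.factorial : ℝ) * Gamma (k + c))| ≤
      (Gamma c)⁻¹ * ((3 * √|z|) ^ (2 * k) / ((2 * k).factorial : ℝ)) := by
  have h0 : 0 < Gamma c := Gamma_pos_of_pos (by linarith)
  have h1 : 0 < Gamma (k + c) := Gamma_pos_of_pos (by positivity)
  have h2 : (3 * √|z|) ^ (2 * k) = 9 ^ k * |z| ^ k := by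
    rw [pow_mul, mul_pow, sq_sqrt (abs_nonneg z), ← mul_pow]
    norm_num
  have h3 := factorial_two_mul_mul_Gamma_le hc k
  rw [abs_div, abs_pow, abs_of_pos (by positivity : 0 < (k.factorial : ℝ) * Gamma (k + c)), h2,
    inv_mul_eq_div, div_div, div_le_div_iff₀ (by positivity) (by positivity)]
  have h4 : 0 ≤ |z| ^ k := by positivity
  nlinarith

theorem summable_hypLimit {c : ℝ} (hc : 1 / 3 ≤ c) (z : ℝ) :
    Summable fun k : ℕ => z ^ k / ((k.factorial : ℝ) * Gamma (k + c)) :=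
  .of_norm_bounded ((hasSum_cosh (3 * √|z|)).summable.mul_left _) (hypLimit_term_le hc z)

theorem abs_hypLimit_le {c : ℝ} (hc : 1 / 3 ≤ c) (z : ℝ) :
    |hypLimit c z| ≤ (Gamma c)⁻¹ * exp (3 * √|z|) := by
  have h0 : 0 < Gamma c := Gamma_pos_of_pos (by linarith)
  have h1 : |hypLimit c z| ≤ (Gamma c)⁻¹ * cosh (3 * √|z|) := by
    rw [← norm_eq_abs]
    exact tsum_of_norm_bounded ((hasSum_cosh (3 * √|z|)).mul_left _) (hypLimit_term_le hc z)
  refine h1.trans ?_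
  gcongr
  rw [cosh_eq]
  have : exp (-(3 * √|z|)) ≤ exp (3 * √|z|) := exp_le_exp.2 (by linarith [sqrt_nonneg |z|])
  linarith

theorem hypLimit_zero (c : ℝ) : hypLimit c 0 = (Gamma c)⁻¹ := by
  rw [hypLimit, tsum_eq_single 0 (fun k hk => by simp [hk])]
  simp

theorem hypLimit_term_succ {c : ℝ} (z : ℝ) (k : ℕ) :
    ((k + 1 : ℕ) : ℝ) * z ^ (k + 1 - 1) / (((k + 1).factorial : ℝ) * Gamma ((k + 1 : ℕ) + c)) =
      z ^ k / ((k.factorial : ℝ) * Gamma (k + (c + 1))) := by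
  have h : ((k + 1 : ℕ) : ℝ) ≠ 0 := by positivity
  rw [Nat.factorial_succ, Nat.add_sub_cancel, show ((k + 1 : ℕ) : ℝ) + c = k + (c + 1) by
    push_cast; ring]
  push_cast at h ⊢
  rw [mul_assoc, mul_div_mul_left _ _ h]

theorem hasDerivAt_hypLimit {c : ℝ} (hc : 1 / 3 ≤ c) (z : ℝ) :
    HasDerivAt (hypLimit c) (hypLimit (c + 1) z) z := by
  let g' : ℕ → ℝ → ℝ := fun k y => k * y ^ (k - 1) / ((k.factorial : ℝ) * Gamma (k + c))
  have hsum : ∀ y, Summable fun k => g' k y := fun y => by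
    rw [← summable_nat_add_iff 1]
    refine (summable_hypLimit (c := c + 1) (by linarith) y).congr fun k => ?_
    exact (hypLimit_term_succ y k).symm
  have hval : ∑' k, g' k z = hypLimit (c + 1) z := by
    rw [(hsum z).tsum_eq_zero_add, hypLimit]
    simp only [g', hypLimit_term_succ]
    simp
  rw [← hval]
  have hz : z ∈ Set.Ioo (-(|z| + 1)) (|z| + 1) := by
    constructor <;> linarith [le_abs_self z, neg_abs_le z]
  refine hasDerivAt_tsum_of_isPreconnected (hsum (|z| + 1)) isOpen_Ioo
    (convex_Ioo _ _).isPreconnected (fun k y _ => ?_) (fun k y hy => ?_) hz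
    (summable_hypLimit hc z) hz
  · exact (hasDerivAt_pow k y).div_const _
  · have h1 : 0 < Gamma (k + c) := Gamma_pos_of_pos (by positivity)
    have h2 : |y| ≤ |z| + 1 := (abs_lt.2 hy).le
    simp only [g', norm_eq_abs, abs_div, abs_mul, abs_pow, Nat.abs_cast, abs_of_pos h1]
    gcongr

theorem hypLimit_contiguous {c : ℝ} (hc : 1 / 3 ≤ c) (z : ℝ) :
    hypLimit c z = z * hypLimit (c + 2) z + c * hypLimit (c + 1) z := by
  have e : ∀ k : ℕ, z * (k * z ^ (k - 1) / ((k.factorial : ℝ) * Gamma (k + (c + 1)))) =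
      k * z ^ k / ((k.factorial : ℝ) * Gamma (k + (c + 1))) := fun k => by
    rcases k with _ | k
    · simp
    · rw [Nat.add_sub_cancel, pow_succ]
      ring
  have h1 : HasSum (fun k : ℕ => k * z ^ (k - 1) / ((k.factorial : ℝ) * Gamma (k + (c + 1))))
      (hypLimit (c + 2) z) := by
    rw [← hasSum_nat_add_iff' 1]
    simp only [hypLimit_term_succ, show c + 1 + 1 = c + 2 by ring]
    simpa [hypLimit] using (summable_hypLimit (c := c + 2) (by linarith) z).hasSum
  have h2 := (h1.mul_left z).add
    ((summable_hypLimit (c := c + 1) (by linarith) z).hasSum.mul_left c)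
  refine HasSum.tsum_eq (h2.congr_fun fun k => ?_)
  have hk : (k : ℝ) + c ≠ 0 := by positivity
  have h3 : Gamma (k + (c + 1)) = (k + c) * Gamma (k + c) := by
    rw [← Gamma_add_one hk, add_assoc]
  have h4 : Gamma (k + c) ≠ 0 := (Gamma_pos_of_pos (by positivity)).ne'
  rw [e, h3]
  field_simp

/-- The entire extension of `airyBi`. -/
noncomputable def biExt (x : ℝ) : ℝ :=
  3 ^ (-(1 / 6) : ℝ) * hypLimit (2 / 3) (x ^ 3 / 9) +
    3 ^ (-(5 / 6) : ℝ) * (x * hypLimit (4 / 3) (x ^ 3 / 9))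

/-- The derivative of `biExt`. -/
noncomputable def biExtDeriv (x : ℝ) : ℝ :=
  3 ^ (-(1 / 6) : ℝ) * (x ^ 2 / 3 * hypLimit (5 / 3) (x ^ 3 / 9)) +
    3 ^ (-(5 / 6) : ℝ) * (3 * hypLimit (1 / 3) (x ^ 3 / 9))

theorem hasDerivAt_hypLimit_cube {c : ℝ} (hc : 1 / 3 ≤ c) (x : ℝ) :
    HasDerivAt (fun x => hypLimit c (x ^ 3 / 9)) (hypLimit (c + 1) (x ^ 3 / 9) * (x ^ 2 / 3)) x := by
  have h : HasDerivAt (fun x : ℝ => x ^ 3 / 9) (x ^ 2 / 3) x := by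
    refine ((hasDerivAt_pow 3 x).div_const 9).congr_deriv ?_
    push_cast
    ring
  exact (hasDerivAt_hypLimit hc _).comp x h

theorem hasDerivAt_biExt (x : ℝ) : HasDerivAt biExt (biExtDeriv x) x := by
  have h1 := (hasDerivAt_hypLimit_cube (c := 2 / 3) (by norm_num) x).const_mul
    ((3 : ℝ) ^ (-(1 / 6) : ℝ))
  have h2 := ((hasDerivAt_id x).mul
    (hasDerivAt_hypLimit_cube (c := 4 / 3) (by norm_num) x)).const_mul ((3 : ℝ) ^ (-(5 / 6) : ℝ))
  refine (h1.add h2).congr_deriv ?_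
  have h3 := hypLimit_contiguous (c := 1 / 3) le_rfl (x ^ 3 / 9)
  rw [biExtDeriv, h3]
  norm_num
  ring

theorem hasDerivAt_biExtDeriv (x : ℝ) : HasDerivAt biExtDeriv (x * biExt x) x := by
  have h1 := ((((hasDerivAt_pow 2 x).div_const 3).mul
    (hasDerivAt_hypLimit_cube (c := 5 / 3) (by norm_num) x))).const_mul ((3 : ℝ) ^ (-(1 / 6) : ℝ))
  have h2 := ((hasDerivAt_hypLimit_cube (c := 1 / 3) le_rfl x).const_mul 3).const_mul
    ((3 : ℝ) ^ (-(5 / 6) : ℝ))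
  refine (h1.add h2).congr_deriv ?_
  have h3 := hypLimit_contiguous (c := 2 / 3) (by norm_num) (x ^ 3 / 9)
  rw [biExt, h3]
  norm_num
  ring

theorem biExt_zero : biExt 0 = 3 ^ (-(1 / 6) : ℝ) * (Gamma (2 / 3))⁻¹ := by
  simp [biExt, hypLimit_zero]

theorem biExtDeriv_zero : biExtDeriv 0 = 3 ^ (-(5 / 6) : ℝ) * (3 * (Gamma (1 / 3))⁻¹) := by
  simp [biExtDeriv, hypLimit_zero]

theorem abs_hypLimit_cube_le {c : ℝ} (hc : 1 / 3 ≤ c) {x : ℝ} (hx : 0 ≤ x) :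
    |hypLimit c (x ^ 3 / 9)| ≤ (Gamma c)⁻¹ * exp (x * √x) := by
  convert abs_hypLimit_le hc (x ^ 3 / 9) using 3
  have : x ^ 3 / 9 = (x * √x / 3) ^ 2 := by
    rw [div_pow, mul_pow, sq_sqrt hx]
    ring
  rw [abs_of_nonneg (by positivity), this, sqrt_sq (by positivity)]
  ring

theorem exists_abs_biExt_le :
    ∃ C, ∀ x, 0 ≤ x → |biExt x| ≤ C * exp (2 * x + x * √x) ∧
      |biExtDeriv x| ≤ C * exp (2 * x + x * √x) := by
  have hG : ∀ c : ℝ, 0 < c → 0 < (Gamma c)⁻¹ := fun c hc => inv_pos.2 (Gamma_pos_of_pos hc)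
  have g1 := hG (1 / 3) (by norm_num)
  have g2 := hG (2 / 3) (by norm_num)
  have g4 := hG (4 / 3) (by norm_num)
  have g5 := hG (5 / 3) (by norm_num)
  have p : (0 : ℝ) < 3 ^ (-(1 / 6) : ℝ) := by positivity
  have q : (0 : ℝ) < 3 ^ (-(5 / 6) : ℝ) := by positivity
  set P : ℝ := 3 ^ (-(1 / 6) : ℝ)
  set Q : ℝ := 3 ^ (-(5 / 6) : ℝ)
  refine ⟨P * (Gamma (2 / 3))⁻¹ + Q * (Gamma (4 / 3))⁻¹ +
    (P * (Gamma (5 / 3))⁻¹ + Q * (3 * (Gamma (1 / 3))⁻¹)), fun x hx => ?_⟩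
  have e1 : 1 ≤ exp (2 * x) := one_le_exp (by linarith)
  have e2 : x ≤ exp (2 * x) := by linarith [add_one_le_exp (2 * x)]
  have e3 : x ^ 2 / 3 ≤ exp (2 * x) := by linarith [quadratic_le_exp_of_nonneg (x := 2 * x) (by linarith), sq_nonneg x]
  have hE := exp_pos (x * √x)
  have h2 := abs_hypLimit_cube_le (c := 2 / 3) (by norm_num) hx
  have h4 := abs_hypLimit_cube_le (c := 4 / 3) (by norm_num) hx
  have h5 := abs_hypLimit_cube_le (c := 5 / 3) (by norm_num) hx
  have h1 := abs_hypLimit_cube_le (c := 1 / 3) le_rfl hx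
  rw [exp_add]
  set E := exp (x * √x)
  set F := exp (2 * x)
  have hF : 0 < F := by positivity
  constructor
  · calc |biExt x| ≤ P * |hypLimit (2 / 3) (x ^ 3 / 9)| + Q * (x * |hypLimit (4 / 3) (x ^ 3 / 9)|) := by
          refine (abs_add_le _ _).trans_eq ?_
          simp only [abs_mul, abs_of_pos p, abs_of_pos q, abs_of_nonneg hx, P, Q]
      _ ≤ P * (F * ((Gamma (2 / 3))⁻¹ * E)) + Q * (F * ((Gamma (4 / 3))⁻¹ * E)) := by
          gcongr
          exact h2.trans (le_mul_of_one_le_left (by positivity) e1)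
      _ = (P * (Gamma (2 / 3))⁻¹ + Q * (Gamma (4 / 3))⁻¹) * (F * E) := by ring
      _ ≤ _ := mul_le_mul_of_nonneg_right (le_add_of_nonneg_right (by positivity)) (by positivity)
  · calc |biExtDeriv x| ≤ P * (x ^ 2 / 3 * |hypLimit (5 / 3) (x ^ 3 / 9)|) +
            Q * (3 * |hypLimit (1 / 3) (x ^ 3 / 9)|) := by
          refine (abs_add_le _ _).trans_eq ?_
          simp only [abs_mul, abs_of_pos p, abs_of_pos q, P, Q,
            abs_of_nonneg (show 0 ≤ x ^ 2 / 3 by positivity), abs_of_pos (show (0 : ℝ) < 3 by norm_num)]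
      _ ≤ P * (F * ((Gamma (5 / 3))⁻¹ * E)) + Q * (3 * (F * ((Gamma (1 / 3))⁻¹ * E))) := by
          gcongr
          exact h1.trans (le_mul_of_one_le_left (by positivity) e1)
      _ = (P * (Gamma (5 / 3))⁻¹ + Q * (3 * (Gamma (1 / 3))⁻¹)) * (F * E) := by ring
      _ ≤ _ := mul_le_mul_of_nonneg_right (le_add_of_nonneg_left (by positivity)) (by positivity)

theorem besselI_eq_hypLimit (ν : ℝ) {y : ℝ} (hy : 0 < y) :
    besselI ν y = (y / 2) ^ ν * hypLimit (ν + 1) ((y / 2) ^ 2) := by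
  rw [besselI, hypLimit, ← tsum_mul_left]
  refine tsum_congr fun k => ?_
  rw [rpow_add (by positivity), show 2 * (k : ℝ) = ((2 * k : ℕ) : ℝ) by push_cast; ring,
    rpow_natCast, pow_mul, add_assoc]
  ring

theorem airyBi_eq_biExt {x : ℝ} (hx : 0 < x) : airyBi x = biExt x := by
  have hy : 0 < (2 / 3) * x ^ ((3 : ℝ) / 2) := by positivity
  have h2 : (2 / 3) * x ^ ((3 : ℝ) / 2) / 2 = 3 ^ (-1 : ℝ) * x ^ ((3 : ℝ) / 2) := by
    rw [rpow_neg_one]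
    ring
  have hz : ((2 / 3) * x ^ ((3 : ℝ) / 2) / 2) ^ 2 = x ^ 3 / 9 := by
    rw [h2, mul_pow, ← rpow_natCast (x ^ ((3 : ℝ) / 2)), ← rpow_mul hx.le, rpow_neg_one]
    norm_num
    ring
  have hs : √(x / 3) = x ^ ((1 : ℝ) / 2) * 3 ^ (-(1 / 2) : ℝ) := by
    rw [sqrt_eq_rpow, div_rpow hx.le (by norm_num), rpow_neg (by norm_num)]
    rfl
  rw [airyBi, besselI_eq_hypLimit _ hy, besselI_eq_hypLimit _ hy, hz, h2, hs, biExt,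
    mul_rpow (by positivity) (by positivity), mul_rpow (by positivity) (by positivity),
    ← rpow_mul hx.le, ← rpow_mul hx.le, ← rpow_mul (by norm_num), ← rpow_mul (by norm_num)]
  have k1 : (3 : ℝ) ^ (-(1 / 6) : ℝ) = 3 ^ (-(1 / 2) : ℝ) * 3 ^ (-1 * -(1 / 3) : ℝ) := by
    rw [← rpow_add (by norm_num)]
    norm_num
  have k2 : (3 : ℝ) ^ (-(5 / 6) : ℝ) = 3 ^ (-(1 / 2) : ℝ) * 3 ^ (-1 * (1 / 3) : ℝ) := by
    rw [← rpow_add (by norm_num)]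
    norm_num
  have k3 : x ^ ((1 : ℝ) / 2) * x ^ ((3 : ℝ) / 2 * (1 / 3)) = x := by
    rw [← rpow_add hx]
    norm_num
  have k4 : x ^ ((1 : ℝ) / 2) * x ^ ((3 : ℝ) / 2 * -(1 / 3)) = 1 := by
    rw [← rpow_add hx]
    norm_num
  rw [k1, k2]
  norm_num at k3 k4 ⊢
  linear_combination ((3 : ℝ) ^ (-(1 / 2) : ℝ) * 3 ^ (-(1 / 3) : ℝ) * hypLimit (4 / 3) (x ^ 3 / 9)) * k3 +
    ((3 : ℝ) ^ (-(1 / 2) : ℝ) * 3 ^ ((1 / 3) : ℝ) * hypLimit (2 / 3) (x ^ 3 / 9)) * k4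

/-- The kernel of the integral representation of `airyAi`. -/
noncomputable def airyKernel (x p : ℝ) : ℝ := exp (-(p ^ 3 / 3 + x ^ 3 / (3 * p ^ 3)))

/-- The moments of `airyKernel`. -/
noncomputable def airyMoment (k : ℕ) (x : ℝ) : ℝ :=
  ∫ p in Set.Ioi (0 : ℝ), p ^ k * airyKernel x p

theorem integrableOn_pow_mul_exp_neg_mul_cube (k : ℕ) {c : ℝ} (hc : 0 < c) :
    IntegrableOn (fun p : ℝ => p ^ k * exp (-c * p ^ 3)) (Set.Ioi 0) := by
  have h := integrableOn_rpow_mul_exp_neg_mul_rpow (p := 3) (s := k) (b := c)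
    (by linarith [k.cast_nonneg (α := ℝ)]) (by norm_num) hc
  refine h.congr_fun (fun p _ => ?_) measurableSet_Ioi
  simp only [rpow_natCast]
  norm_cast

theorem measurable_airyKernel (x : ℝ) : Measurable (airyKernel x) := by
  unfold airyKernel
  fun_prop

theorem airyKernel_pos (x p : ℝ) : 0 < airyKernel x p := exp_pos _

theorem airyKernel_le {x p : ℝ} (hx : 0 ≤ x) (hp : 0 < p) :
    airyKernel x p ≤ exp (-(1 / 3) * p ^ 3) := by
  have : 0 ≤ x ^ 3 / (3 * p ^ 3) := by positivity
  exact exp_le_exp.2 (by linarith)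

theorem airyKernel_le' {x p : ℝ} (hx : 0 ≤ x) (hp : 0 < p) :
    airyKernel x p ≤ exp (-(x * √x / 2)) * exp (-(1 / 12) * p ^ 3) := by
  rw [← exp_add]
  refine exp_le_exp.2 ?_
  have h1 : x ^ 3 = (x * √x) ^ 2 := by
    rw [mul_pow, sq_sqrt hx]
    ring
  have hq : 0 < p ^ 3 := by positivity
  rw [h1]
  set w := x * √x
  set q := p ^ 3
  have h2 : q / 4 + w ^ 2 / (3 * q) - w / 2 = (3 * (q - w) ^ 2 + w ^ 2) / (12 * q) := by
    field_simp
    ring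
  have h3 : 0 ≤ (3 * (q - w) ^ 2 + w ^ 2) / (12 * q) := by positivity
  linarith

theorem integrableOn_airyMoment (k : ℕ) {x : ℝ} (hx : 0 ≤ x) :
    IntegrableOn (fun p => p ^ k * airyKernel x p) (Set.Ioi 0) := by
  refine (integrableOn_pow_mul_exp_neg_mul_cube k (c := 1 / 3) (by norm_num)).mono'
    ((measurable_id.pow_const k).mul (measurable_airyKernel x)).aestronglyMeasurable ?_
  refine (ae_restrict_mem measurableSet_Ioi).mono fun p (hp : 0 < p) => ?_
  have h := airyKernel_pos x p
  rw [norm_of_nonneg (by positivity)]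
  gcongr
  exact airyKernel_le hx hp

theorem exists_abs_airyMoment_le (k : ℕ) :
    ∃ C, ∀ x, 0 ≤ x → |airyMoment k x| ≤ C * exp (-(x * √x / 2)) := by
  refine ⟨∫ p in Set.Ioi (0 : ℝ), p ^ k * exp (-(1 / 12) * p ^ 3), fun x hx => ?_⟩
  have hi := integrableOn_pow_mul_exp_neg_mul_cube k (c := 1 / 12) (by norm_num)
  rw [← integral_mul_const, ← norm_eq_abs]
  refine norm_integral_le_of_norm_le (hi.mul_const _) ?_
  refine (ae_restrict_mem measurableSet_Ioi).mono fun p (hp : 0 < p) => ?_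
  have h := airyKernel_pos x p
  rw [norm_of_nonneg (by positivity), mul_assoc, mul_comm (exp _)]
  gcongr
  exact airyKernel_le' hx hp

theorem continuousWithinAt_airyMoment (k : ℕ) :
    ContinuousWithinAt (airyMoment k) (Set.Ici 0) 0 := by
  refine continuousWithinAt_of_dominated
    (bound := fun p => p ^ k * exp (-(1 / 3) * p ^ 3)) ?_ ?_
    (integrableOn_pow_mul_exp_neg_mul_cube k (by norm_num)) ?_
  · exact .of_forall fun x =>
      ((measurable_id.pow_const k).mul (measurable_airyKernel x)).aestronglyMeasurable
  · refine eventually_mem_nhdsWithin.mono fun x (hx : 0 ≤ x) => ?_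
    refine (ae_restrict_mem measurableSet_Ioi).mono fun p (hp : 0 < p) => ?_
    have h := airyKernel_pos x p
    rw [norm_of_nonneg (by positivity)]
    gcongr
    exact airyKernel_le hx hp
  · refine .of_forall fun p => Continuous.continuousWithinAt ?_
    unfold airyKernel
    fun_prop

theorem hasDerivAt_airyKernel (x p : ℝ) :
    HasDerivAt (fun x => airyKernel x p) (-(x ^ 2 / p ^ 3 * airyKernel x p)) x := by
  have h := ((((hasDerivAt_pow 3 x).div_const (3 * p ^ 3)).const_add (p ^ 3 / 3)).neg).exp
  refine h.congr_deriv ?_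
  have h3 : ((3 : ℕ) : ℝ) * x ^ (3 - 1) / (3 * p ^ 3) = x ^ 2 / p ^ 3 := by
    push_cast
    rw [mul_div_mul_left _ _ three_ne_zero]
  rw [h3, mul_neg, mul_comm]
  rfl

theorem sq_div_cube_mul_airyKernel_le {x p : ℝ} (hx : 0 < x) (hp : 0 < p) :
    x ^ 2 / p ^ 3 * airyKernel x p ≤ 3 / x * exp (-(1 / 3) * p ^ 3) := by
  set u := x ^ 3 / (3 * p ^ 3) with hu
  have h1 : x ^ 2 / p ^ 3 = 3 / x * u := by
    rw [hu]
    field_simp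
  have h2 : u * exp (-u) ≤ 1 := by
    rw [exp_neg, ← div_eq_mul_inv, div_le_one (exp_pos _)]
    linarith [add_one_le_exp u]
  rw [h1, airyKernel, ← hu, neg_add, exp_add, show -(1 / 3) * p ^ 3 = -(p ^ 3 / 3) by ring]
  calc 3 / x * u * (exp (-(p ^ 3 / 3)) * exp (-u))
      = 3 / x * (exp (-(p ^ 3 / 3)) * (u * exp (-u))) := by ring
    _ ≤ 3 / x * (exp (-(p ^ 3 / 3)) * 1) := by gcongr
    _ = _ := by ring

theorem hasDerivAt_airyMoment_aux (k : ℕ) {x : ℝ} (hx : 0 < x) :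
    HasDerivAt (airyMoment k)
      (∫ p in Set.Ioi (0 : ℝ), p ^ k * -(x ^ 2 / p ^ 3 * airyKernel x p)) x := by
  refine (hasDerivAt_integral_of_dominated_loc_of_deriv_le (s := Set.Ioi (x / 2))
    (F := fun x p => p ^ k * airyKernel x p)
    (F' := fun x p => p ^ k * -(x ^ 2 / p ^ 3 * airyKernel x p))
    (bound := fun p => 3 / (x / 2) * (p ^ k * exp (-(1 / 3) * p ^ 3)))
    (Ioi_mem_nhds (by linarith)) ?_ (integrableOn_airyMoment k hx.le) ?_ ?_ ?_ ?_).2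
  · exact .of_forall fun x =>
      ((measurable_id.pow_const k).mul (measurable_airyKernel x)).aestronglyMeasurable
  · have := measurable_airyKernel x
    exact Measurable.aestronglyMeasurable (by fun_prop)
  · refine (ae_restrict_mem measurableSet_Ioi).mono fun p (hp : 0 < p) y (hy : x / 2 < y) => ?_
    have hy0 : 0 < y := by linarith
    have h := airyKernel_pos y p
    rw [mul_neg, norm_neg, norm_of_nonneg (by positivity), mul_left_comm (3 / (x / 2))]
    refine mul_le_mul_of_nonneg_left ((sq_div_cube_mul_airyKernel_le hy0 hp).trans ?_)
      (by positivity)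
    gcongr
  · exact (integrableOn_pow_mul_exp_neg_mul_cube k (by norm_num)).const_mul _
  · exact .of_forall fun p y _ => (hasDerivAt_airyKernel y p).const_mul _

theorem integral_Ioi_comp_const_div (g : ℝ → ℝ) {x : ℝ} (hx : 0 < x) :
    ∫ p in Set.Ioi (0 : ℝ), g p = ∫ p in Set.Ioi (0 : ℝ), x / p ^ 2 * g (x / p) := by
  have himg : (fun p : ℝ => x / p) '' Set.Ioi 0 = Set.Ioi 0 := by
    ext q
    constructor
    · rintro ⟨p, hp : 0 < p, rfl⟩
      exact div_pos hx hp
    · intro (hq : 0 < q)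
      exact ⟨x / q, div_pos hx hq, by field_simp⟩
  have h := integral_image_eq_integral_abs_deriv_smul (f := fun p : ℝ => x / p)
    (f' := fun p => -(x / p ^ 2)) (measurableSet_Ioi (a := (0 : ℝ))) (fun p (hp : 0 < p) => ?_) ?_ g
  · rw [himg] at h
    rw [h]
    refine setIntegral_congr_fun measurableSet_Ioi fun p (hp : 0 < p) => ?_
    simp only [smul_eq_mul, abs_neg]
    rw [abs_of_pos (by positivity)]
  · refine HasDerivAt.hasDerivWithinAt ?_
    refine ((hasDerivAt_inv hp.ne').const_mul x).congr_deriv ?_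
    ring
  · intro p (hp : 0 < p) q (hq : 0 < q) (hpq : x / p = x / q)
    field_simp at hpq
    exact hpq.symm

theorem airyKernel_const_div {x p : ℝ} (hx : 0 < x) (hp : 0 < p) :
    airyKernel x (x / p) = airyKernel x p := by
  unfold airyKernel
  congr 2
  field_simp
  ring

theorem hasDerivAt_airyMoment_zero {x : ℝ} (hx : 0 < x) :
    HasDerivAt (airyMoment 0) (-airyMoment 1 x) x := by
  refine (hasDerivAt_airyMoment_aux 0 hx).congr_deriv ?_
  rw [integral_Ioi_comp_const_div _ hx, airyMoment, ← integral_neg]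
  refine setIntegral_congr_fun measurableSet_Ioi fun p (hp : 0 < p) => ?_
  simp only [airyKernel_const_div hx hp]
  field_simp

theorem hasDerivAt_airyMoment_one {x : ℝ} (hx : 0 < x) :
    HasDerivAt (airyMoment 1) (-(x * airyMoment 0 x)) x := by
  refine (hasDerivAt_airyMoment_aux 1 hx).congr_deriv ?_
  rw [integral_Ioi_comp_const_div _ hx, airyMoment, ← integral_const_mul, ← integral_neg]
  refine setIntegral_congr_fun measurableSet_Ioi fun p (hp : 0 < p) => ?_
  simp only [airyKernel_const_div hx hp]
  field_simp

theorem airyMoment_zero_right (k : ℕ) :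
    airyMoment k 0 =
      (1 / 3 : ℝ) ^ (-((k : ℝ) + 1) / 3) * (1 / 3) * Gamma (((k : ℝ) + 1) / 3) := by
  rw [← integral_rpow_mul_exp_neg_mul_rpow (by norm_num)
    (by linarith [k.cast_nonneg (α := ℝ)]) (by norm_num), airyMoment]
  refine setIntegral_congr_fun measurableSet_Ioi fun p _ => ?_
  simp only [airyKernel, rpow_natCast]
  congr 2
  norm_num
  ring

theorem airyKernel_sqrt_mul_exp {x : ℝ} (hx : 0 < x) (t : ℝ) :
    airyKernel x (√x * exp (t / 3)) = exp (-((2 / 3) * x ^ ((3 : ℝ) / 2)) * cosh t) := by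
  have h1 : x ^ ((3 : ℝ) / 2) = √x ^ 3 := by
    rw [sqrt_eq_rpow, ← rpow_natCast, ← rpow_mul hx.le]
    norm_num
  have h2 : exp (t / 3) ^ 3 = exp t := by
    rw [← exp_nat_mul]
    congr 1
    push_cast
    ring
  have h3 : x ^ 3 = √x ^ 3 * √x ^ 3 := by
    rw [← mul_pow, mul_self_sqrt hx.le]
  have h4 : 0 < √x := sqrt_pos.2 hx
  rw [airyKernel, h1, mul_pow, h2, h3, cosh_eq, exp_neg t]
  congr 1
  field_simp

theorem airyMoment_zero_eq_besselK {x : ℝ} (hx : 0 < x) :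
    airyMoment 0 x = 2 / 3 * √x * besselK (1 / 3) ((2 / 3) * x ^ ((3 : ℝ) / 2)) := by
  have h4 : 0 < √x := sqrt_pos.2 hx
  have himg : (fun t : ℝ => √x * exp (t / 3)) '' Set.univ = Set.Ioi 0 := by
    ext q
    constructor
    · rintro ⟨p, -, rfl⟩
      exact mul_pos h4 (exp_pos _)
    · intro (hq : 0 < q)
      refine ⟨3 * log (q / √x), trivial, ?_⟩
      simp only
      rw [mul_div_cancel_left₀ _ three_ne_zero, exp_log (by positivity)]
      field_simp
  have hderiv : ∀ t ∈ Set.univ, HasDerivWithinAt (fun t : ℝ => √x * exp (t / 3))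
      (√x * exp (t / 3) / 3) Set.univ t := fun t _ => by
    refine HasDerivAt.hasDerivWithinAt ?_
    refine ((((hasDerivAt_id t).div_const 3).exp).const_mul √x).congr_deriv ?_
    simp only [id]
    ring
  have hinj : Set.InjOn (fun t : ℝ => √x * exp (t / 3)) Set.univ := fun s _ t _ h => by
    have := exp_injective (mul_left_cancel₀ h4.ne' h)
    linarith
  set y := (2 / 3) * x ^ ((3 : ℝ) / 2) with hy
  set h : ℝ → ℝ := fun t => exp (-y * cosh t) * exp (t / 3) with hh
  have hterm : ∀ t, |√x * exp (t / 3) / 3| •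
      ((√x * exp (t / 3)) ^ 0 * airyKernel x (√x * exp (t / 3))) = √x / 3 * h t := fun t => by
    rw [airyKernel_sqrt_mul_exp hx, abs_of_pos (by positivity), smul_eq_mul, hh]
    ring
  have hmom : airyMoment 0 x = √x / 3 * ∫ t, h t := by
    rw [airyMoment, ← himg, integral_image_eq_integral_abs_deriv_smul .univ hderiv hinj]
    simp only [hterm]
    rw [setIntegral_univ, integral_const_mul]
  have hint : Integrable h := by
    have h1 := integrableOn_airyMoment 0 hx.le
    rw [← himg, integrableOn_image_iff_integrableOn_abs_deriv_smul .univ hderiv hinj] at h1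
    simp only [hterm] at h1
    rw [integrableOn_univ] at h1
    exact (integrable_const_mul_iff (IsUnit.mk0 _ (by positivity)) _).1 h1
  have hsymm : ∫ t, h t = ∫ t, exp (-y * cosh t) * cosh (1 / 3 * t) := by
    have h1 : ∫ t, h t = ∫ t, h (-t) := (integral_neg_eq_self h volume).symm
    have h2 : ∫ t, h t = ∫ t, (h t + h (-t)) / 2 := by
      rw [integral_div, integral_add hint hint.comp_neg, ← h1]
      ring
    rw [h2]
    refine integral_congr_ae (.of_forall fun t => ?_)
    simp only [hh, cosh_neg, cosh_eq (1 / 3 * t)]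
    rw [show 1 / 3 * t = t / 3 by ring, neg_div]
    ring
  have heven : ∫ t, exp (-y * cosh t) * cosh (1 / 3 * t) = 2 * besselK (1 / 3) y := by
    rw [besselK, ← integral_comp_abs]
    refine integral_congr_ae (.of_forall fun t => ?_)
    simp only [cosh_abs]
    rcases abs_choice t with ht | ht <;> simp [ht]
  rw [hmom, hsymm, heven]
  ring

/-- The continuous extension of `airyAi` to `[0, ∞)`. -/
noncomputable def aiExt (x : ℝ) : ℝ := √3 / (2 * π) * airyMoment 0 x

/-- The derivative of `aiExt`. -/
noncomputable def aiExtDeriv (x : ℝ) : ℝ := -(√3 / (2 * π) * airyMoment 1 x)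

theorem airyAi_eq_aiExt {x : ℝ} (hx : 0 < x) : airyAi x = aiExt x := by
  have h3 : √3 * √3 = 3 := mul_self_sqrt (by norm_num)
  have : (0 : ℝ) < √3 := by positivity
  have := pi_pos
  rw [airyAi, aiExt, airyMoment_zero_eq_besselK hx, sqrt_div hx.le]
  generalize besselK (1 / 3) ((2 / 3) * x ^ ((3 : ℝ) / 2)) = K
  field_simp
  linear_combination (-K) * h3

theorem hasDerivAt_aiExt {x : ℝ} (hx : 0 < x) : HasDerivAt aiExt (aiExtDeriv x) x := by
  refine ((hasDerivAt_airyMoment_zero hx).const_mul (√3 / (2 * π))).congr_deriv ?_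
  rw [aiExtDeriv]
  ring

theorem hasDerivAt_aiExtDeriv {x : ℝ} (hx : 0 < x) : HasDerivAt aiExtDeriv (x * aiExt x) x := by
  refine ((hasDerivAt_airyMoment_one hx).const_mul (√3 / (2 * π))).neg.congr_deriv ?_
  rw [aiExt]
  ring

theorem continuousWithinAt_aiExt : ContinuousWithinAt aiExt (Set.Ici 0) 0 :=
  (continuousWithinAt_airyMoment 0).const_mul _

theorem continuousWithinAt_aiExtDeriv : ContinuousWithinAt aiExtDeriv (Set.Ici 0) 0 :=
  ((continuousWithinAt_airyMoment 1).const_mul _).neg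

theorem exists_abs_aiExt_le :
    ∃ C, ∀ x, 0 ≤ x → |aiExt x| ≤ C * exp (-(x * √x / 2)) ∧
      |aiExtDeriv x| ≤ C * exp (-(x * √x / 2)) := by
  obtain ⟨C, hC⟩ := exists_abs_airyMoment_le 0
  obtain ⟨D, hD⟩ := exists_abs_airyMoment_le 1
  refine ⟨√3 / (2 * π) * max C D, fun x hx => ⟨?_, ?_⟩⟩
  · rw [aiExt, abs_mul, abs_of_nonneg (by positivity), mul_assoc]
    gcongr
    exact (hC x hx).trans (by gcongr; exact le_max_left _ _)
  · rw [aiExtDeriv, abs_neg, abs_mul, abs_of_nonneg (by positivity), mul_assoc]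
    gcongr
    exact (hD x hx).trans (by gcongr; exact le_max_right _ _)

theorem Gamma_one_third_mul_Gamma_two_thirds :
    Gamma (1 / 3) * Gamma (2 / 3) = 2 * π / √3 := by
  have h := Gamma_mul_Gamma_one_sub (1 / 3)
  rw [show (1 : ℝ) - 1 / 3 = 2 / 3 by norm_num, show π * (1 / 3) = π / 3 by ring,
    sin_pi_div_three] at h
  rw [h]
  field_simp

theorem aiExt_zero_mul_aiExtDeriv_zero : aiExt 0 * aiExtDeriv 0 = -(1 / (2 * π * √3)) := by
  have h3 : √3 * √3 = 3 := mul_self_sqrt (by norm_num)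
  have hs : (0 : ℝ) < √3 := by positivity
  have h1 : airyMoment 0 0 * airyMoment 1 0 = 1 / 3 * (2 * π / √3) := by
    rw [← Gamma_one_third_mul_Gamma_two_thirds, airyMoment_zero_right, airyMoment_zero_right]
    have : ((1 : ℝ) / 3) ^ (-(1 : ℝ) / 3) * (1 / 3) ^ (-(2 : ℝ) / 3) = 3 := by
      rw [← rpow_add (by norm_num)]
      norm_num
    norm_num at this ⊢
    linear_combination (Gamma (1 / 3) * Gamma (2 / 3) / 9) * this
  have hpi := pi_pos
  rw [aiExt, aiExtDeriv]
  have : √3 / (2 * π) * airyMoment 0 0 * -(√3 / (2 * π) * airyMoment 1 0) =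
    -(√3 / (2 * π)) * (√3 / (2 * π)) * (airyMoment 0 0 * airyMoment 1 0) := by ring
  rw [this, h1]
  field_simp
  linear_combination -h3

theorem one_third_rpow_neg_div_three (s : ℝ) : (1 / 3 : ℝ) ^ (-s / 3) = 3 ^ (s / 3) := by
  rw [one_div, inv_rpow (by norm_num), neg_div, rpow_neg (by norm_num), inv_inv]

theorem biExt_zero_eq : biExt 0 = √3 * aiExt 0 := by
  have h3 : √3 * √3 = 3 := mul_self_sqrt (by norm_num)
  have hs : (0 : ℝ) < √3 := by positivity
  have hG : 0 < Gamma (2 / 3) := Gamma_pos_of_pos (by norm_num)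
  have h1 : Gamma (1 / 3) = 2 * π / √3 / Gamma (2 / 3) := by
    rw [← Gamma_one_third_mul_Gamma_two_thirds, mul_div_cancel_right₀ _ hG.ne']
  have h2 : (3 : ℝ) ^ (-(1 / 6) : ℝ) * √3 = 3 ^ ((1 : ℝ) / 3) := by
    rw [sqrt_eq_rpow, ← rpow_add (by norm_num)]
    norm_num
  have hpi := pi_pos
  rw [biExt_zero, aiExt, airyMoment_zero_right, Nat.cast_zero, zero_add,
    one_third_rpow_neg_div_three, h1, ← h2]
  field_simp
  linear_combination -h3

theorem biExtDeriv_zero_eq : biExtDeriv 0 = -(√3 * aiExtDeriv 0) := by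
  have h3 : √3 * √3 = 3 := mul_self_sqrt (by norm_num)
  have hs : (0 : ℝ) < √3 := by positivity
  have hG : 0 < Gamma (1 / 3) := Gamma_pos_of_pos (by norm_num)
  have h1 : Gamma (2 / 3) = 2 * π / √3 / Gamma (1 / 3) := by
    rw [← Gamma_one_third_mul_Gamma_two_thirds, mul_div_cancel_left₀ _ hG.ne']
  have h2 : (3 : ℝ) ^ (-(5 / 6) : ℝ) * 3 * √3 = 3 ^ ((2 : ℝ) / 3) := by
    nth_rewrite 2 [← rpow_one 3]
    rw [sqrt_eq_rpow, ← rpow_add (by norm_num), ← rpow_add (by norm_num)]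
    norm_num
  have hpi := pi_pos
  rw [biExtDeriv_zero, aiExtDeriv, airyMoment_zero_right, Nat.cast_one, one_add_one_eq_two,
    one_third_rpow_neg_div_three, h1, ← h2]
  field_simp
  linear_combination -h3

/-- `w` solves `w' = w₁`, `w₁' = w₂`, `w₂' = 4 x w₁ + 2 w` on `(0, ∞)` (the equation of products of
Airy functions), continuously up to `0`, and `w, w₁, w₂` are bounded by `φ`. -/
structure IsAiryProduct (w w₁ w₂ φ : ℝ → ℝ) : Prop where
  hasDerivAt : ∀ x, 0 < x → HasDerivAt w (w₁ x) x
  hasDerivAt₁ : ∀ x, 0 < x → HasDerivAt w₁ (w₂ x) x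
  hasDerivAt₂ : ∀ x, 0 < x → HasDerivAt w₂ (4 * x * w₁ x + 2 * w x) x
  cont : ContinuousWithinAt w (Set.Ici 0) 0
  cont₁ : ContinuousWithinAt w₁ (Set.Ici 0) 0
  cont₂ : ContinuousWithinAt w₂ (Set.Ici 0) 0
  bound : ∀ x, 0 ≤ x → |w x| ≤ φ x
  bound₁ : ∀ x, 0 ≤ x → |w₁ x| ≤ φ x
  bound₂ : ∀ x, 0 ≤ x → |w₂ x| ≤ φ x

theorem isAiryProduct_mul {A A₁ B B₁ α β : ℝ → ℝ}
    (hA : ∀ x, 0 < x → HasDerivAt A (A₁ x) x) (hA₁ : ∀ x, 0 < x → HasDerivAt A₁ (x * A x) x)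
    (hB : ∀ x, 0 < x → HasDerivAt B (B₁ x) x) (hB₁ : ∀ x, 0 < x → HasDerivAt B₁ (x * B x) x)
    (cA : ContinuousWithinAt A (Set.Ici 0) 0) (cA₁ : ContinuousWithinAt A₁ (Set.Ici 0) 0)
    (cB : ContinuousWithinAt B (Set.Ici 0) 0) (cB₁ : ContinuousWithinAt B₁ (Set.Ici 0) 0)
    (bA : ∀ x, 0 ≤ x → |A x| ≤ α x ∧ |A₁ x| ≤ α x)
    (bB : ∀ x, 0 ≤ x → |B x| ≤ β x ∧ |B₁ x| ≤ β x) :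
    IsAiryProduct (fun x => A x * B x) (fun x => A₁ x * B x + A x * B₁ x)
      (fun x => 2 * (A₁ x * B₁ x) + 2 * (x * (A x * B x)))
      (fun x => 4 * (α x * β x) * exp x) where
  hasDerivAt x hx := (hA x hx).mul (hB x hx)
  hasDerivAt₁ x hx := by
    refine (((hA₁ x hx).mul (hB x hx)).add ((hA x hx).mul (hB₁ x hx))).congr_deriv ?_
    ring
  hasDerivAt₂ x hx := by
    refine ((((hA₁ x hx).mul (hB₁ x hx)).const_mul 2).add
      (((hasDerivAt_id x).mul ((hA x hx).mul (hB x hx))).const_mul 2)).congr_deriv ?_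
    simp only [id, Pi.mul_apply]
    ring
  cont := cA.mul cB
  cont₁ := (cA₁.mul cB).add (cA.mul cB₁)
  cont₂ := ((cA₁.mul cB₁).const_mul 2).add
    ((continuousWithinAt_id.mul (cA.mul cB)).const_mul 2)
  bound x hx := by
    obtain ⟨⟨a, -⟩, b, -⟩ := And.intro (bA x hx) (bB x hx)
    have ha := (abs_nonneg _).trans a
    have hb := (abs_nonneg _).trans b
    have h := mul_nonneg ha hb
    have he : 1 ≤ exp x := one_le_exp hx
    have h1 := mul_le_mul a b (abs_nonneg _) ha
    rw [abs_mul]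
    nlinarith
  bound₁ x hx := by
    obtain ⟨⟨a, a₁⟩, b, b₁⟩ := And.intro (bA x hx) (bB x hx)
    have ha := (abs_nonneg _).trans a
    have hb := (abs_nonneg _).trans b
    have h := mul_nonneg ha hb
    have he : 1 ≤ exp x := one_le_exp hx
    have h1 := mul_le_mul a₁ b (abs_nonneg _) ha
    have h2 := mul_le_mul a b₁ (abs_nonneg _) ha
    refine (abs_add_le _ _).trans ?_
    rw [abs_mul, abs_mul]
    nlinarith
  bound₂ x hx := by
    obtain ⟨⟨a, a₁⟩, b, b₁⟩ := And.intro (bA x hx) (bB x hx)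
    have ha := (abs_nonneg _).trans a
    have hb := (abs_nonneg _).trans b
    have h := mul_nonneg ha hb
    have he : 1 ≤ exp x := one_le_exp hx
    have hx' : x ≤ exp x := by linarith [add_one_le_exp x]
    have h1 := mul_le_mul a₁ b₁ (abs_nonneg _) ha
    have h2 := mul_le_mul hx' (mul_le_mul a b (abs_nonneg _) ha) (by positivity) (by positivity)
    refine (abs_add_le _ _).trans ?_
    simp only [abs_mul, abs_two, abs_of_nonneg hx]
    nlinarith

section Pairing

variable {u u₁ u₂ v v₁ v₂ φ ψ : ℝ → ℝ} {C : ℝ}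

theorem continuousOn_comp_mul_left {w w' : ℝ → ℝ} (h : ∀ x, 0 < x → HasDerivAt w (w' x) x) {a : ℝ}
    (ha : 0 < a) : ContinuousOn (fun x => w (a * x)) (Set.Ioi 0) := fun x (hx : 0 < x) =>
  ((h (a * x) (mul_pos ha hx)).continuousAt.comp (f := fun x => a * x)
    (by fun_prop)).continuousWithinAt

theorem hasDerivAt_comp_mul_left {w w' : ℝ → ℝ} (h : ∀ x, 0 < x → HasDerivAt w (w' x) x) {a x : ℝ}
    (ha : 0 < a) (hx : 0 < x) : HasDerivAt (fun x => w (a * x)) (a * w' (a * x)) x := by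
  have h1 : HasDerivAt (fun x => a * x) a x := by simpa using (hasDerivAt_id x).const_mul a
  refine ((h (a * x) (mul_pos ha hx)).comp x h1).congr_deriv (mul_comm _ _)

theorem continuousWithinAt_comp_mul_left {w : ℝ → ℝ} (h : ContinuousWithinAt w (Set.Ici 0) 0)
    {a : ℝ} (ha : 0 < a) : ContinuousWithinAt (fun x => w (a * x)) (Set.Ici 0) 0 := by
  refine ContinuousWithinAt.comp (f := fun x => a * x) (t := Set.Ici 0) (by simpa using h)
    (by fun_prop) fun x (hx : 0 ≤ x) => ?_
  exact mul_nonneg ha.le hx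

theorem abs_mul_le_exp (hC : ∀ s y, 0 ≤ s → s ≤ y → φ s * ψ y ≤ C * exp (-2 * y))
    {p q : ℝ → ℝ} (hp : ∀ x, 0 ≤ x → |p x| ≤ φ x) (hq : ∀ x, 0 ≤ x → |q x| ≤ ψ x)
    {a b x : ℝ} (ha : 0 < a) (hab : a ≤ b) (hx : 0 ≤ x) :
    |p (a * x) * q (b * x)| ≤ C * exp (-(2 * b) * x) := by
  have h1 : 0 ≤ a * x := by positivity
  have h2 : a * x ≤ b * x := by gcongr
  rw [abs_mul, show -(2 * b) * x = -2 * (b * x) by ring]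
  exact (mul_le_mul (hp _ h1) (hq _ (h1.trans h2)) (abs_nonneg _)
    ((abs_nonneg _).trans (hp _ h1))).trans (hC _ _ h1 h2)

theorem id_mul_exp_le {b x : ℝ} (hb : 0 < b) : x * exp (-(2 * b) * x) ≤ b⁻¹ * exp (-b * x) := by
  have h1 : b * x ≤ exp (b * x) := by linarith [add_one_le_exp (b * x)]
  have h2 : exp (-b * x) = exp (b * x) * exp (-(2 * b) * x) := by
    rw [← exp_add]
    congr 1
    ring
  rw [h2]
  have h3 := exp_pos (-(2 * b) * x)
  calc x * exp (-(2 * b) * x) = b⁻¹ * (b * x * exp (-(2 * b) * x)) := by field_simp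
    _ ≤ _ := by gcongr

theorem abs_mul_id_mul_le_exp (hC0 : 0 ≤ C)
    (hC : ∀ s y, 0 ≤ s → s ≤ y → φ s * ψ y ≤ C * exp (-2 * y))
    {p q : ℝ → ℝ} (hp : ∀ x, 0 ≤ x → |p x| ≤ φ x) (hq : ∀ x, 0 ≤ x → |q x| ≤ ψ x)
    {a b m x : ℝ} (ha : 0 < a) (hab : a ≤ b) (hm : 0 < m) (hmb : m ≤ b) (hx : 0 ≤ x) :
    |p (a * x) * (x * q (b * x))| ≤ C * (m⁻¹ * exp (-m * x)) := by
  have h := abs_mul_le_exp hC hp hq ha hab hx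
  rw [mul_left_comm, abs_mul, abs_of_nonneg hx]
  calc x * |p (a * x) * q (b * x)| ≤ x * (C * exp (-(2 * b) * x)) := by gcongr
    _ ≤ x * (C * exp (-(2 * m) * x)) := by gcongr
    _ = C * (x * exp (-(2 * m) * x)) := by ring
    _ ≤ _ := mul_le_mul_of_nonneg_left (id_mul_exp_le hm) hC0

theorem tendsto_exp_neg_mul_atTop {b : ℝ} (hb : 0 < b) (C : ℝ) :
    Filter.Tendsto (fun x => C * exp (-b * x)) Filter.atTop (nhds 0) := by
  have h : Filter.Tendsto (fun x => -b * x) Filter.atTop Filter.atBot :=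
    Filter.tendsto_id.const_mul_atTop_of_neg (by linarith)
  simpa using (tendsto_exp_atBot.comp h).const_mul C

theorem IsAiryProduct.integrableOn_mul (hu : IsAiryProduct u u₁ u₂ φ)
    (hv : IsAiryProduct v v₁ v₂ ψ) (hC : ∀ s y, 0 ≤ s → s ≤ y → φ s * ψ y ≤ C * exp (-2 * y))
    {a b : ℝ} (ha : 0 < a) (hab : a ≤ b) :
    IntegrableOn (fun x => u (a * x) * v (b * x)) (Set.Ioi 0) := by
  have hb := ha.trans_le hab
  refine Integrable.mono' ((exp_neg_integrableOn_Ioi 0 (b := 2 * b) (by linarith)).const_mul C)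
    (((continuousOn_comp_mul_left hu.hasDerivAt ha).mul
      (continuousOn_comp_mul_left hv.hasDerivAt hb)).aestronglyMeasurable measurableSet_Ioi) ?_
  exact (ae_restrict_mem measurableSet_Ioi).mono fun x (hx : 0 < x) =>
    abs_mul_le_exp hC hu.bound hv.bound ha hab hx.le

theorem IsAiryProduct.aestronglyMeasurable_mul_id_mul (hu : IsAiryProduct u u₁ u₂ φ)
    (hv : IsAiryProduct v v₁ v₂ ψ) {a b : ℝ} (ha : 0 < a) (hb : 0 < b) :
    AEStronglyMeasurable (fun x => u (a * x) * (x * v₁ (b * x))) (volume.restrict (Set.Ioi 0)) :=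
  ((continuousOn_comp_mul_left hu.hasDerivAt ha).mul (continuousOn_id.mul
    (continuousOn_comp_mul_left hv.hasDerivAt₁ hb))).aestronglyMeasurable measurableSet_Ioi

theorem IsAiryProduct.integrableOn_mul_id_mul (hu : IsAiryProduct u u₁ u₂ φ)
    (hv : IsAiryProduct v v₁ v₂ ψ) (hC0 : 0 ≤ C)
    (hC : ∀ s y, 0 ≤ s → s ≤ y → φ s * ψ y ≤ C * exp (-2 * y))
    {a b : ℝ} (ha : 0 < a) (hab : a ≤ b) :
    IntegrableOn (fun x => u (a * x) * (x * v₁ (b * x))) (Set.Ioi 0) := by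
  have hb := ha.trans_le hab
  refine Integrable.mono' (((exp_neg_integrableOn_Ioi 0 hb).const_mul b⁻¹).const_mul C)
    (hu.aestronglyMeasurable_mul_id_mul hv ha hb) ?_
  exact (ae_restrict_mem measurableSet_Ioi).mono fun x (hx : 0 < x) =>
    abs_mul_id_mul_le_exp hC0 hC hu.bound hv.bound₁ ha hab hb le_rfl hx.le

theorem IsAiryProduct.hasDerivAt_integral (hu : IsAiryProduct u u₁ u₂ φ)
    (hv : IsAiryProduct v v₁ v₂ ψ) (hC0 : 0 ≤ C)
    (hC : ∀ s y, 0 ≤ s → s ≤ y → φ s * ψ y ≤ C * exp (-2 * y))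
    {a b : ℝ} (ha : 0 < a) (hab : a < b) :
    HasDerivAt (fun b => ∫ x in Set.Ioi (0 : ℝ), u (a * x) * v (b * x))
      (∫ x in Set.Ioi (0 : ℝ), u (a * x) * (x * v₁ (b * x))) b := by
  have hb := ha.trans hab
  refine (hasDerivAt_integral_of_dominated_loc_of_deriv_le (s := Set.Ioi a)
    (F := fun b x => u (a * x) * v (b * x))
    (F' := fun b x => u (a * x) * (x * v₁ (b * x)))
    (bound := fun x => C * (a⁻¹ * exp (-a * x)))
    (Ioi_mem_nhds hab) ?_ (hu.integrableOn_mul hv hC ha hab.le) ?_ ?_ ?_ ?_).2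
  · exact (eventually_gt_nhds hab).mono fun y hy =>
      (hu.integrableOn_mul hv hC ha hy.le).aestronglyMeasurable
  · exact hu.aestronglyMeasurable_mul_id_mul hv ha hb
  · exact (ae_restrict_mem measurableSet_Ioi).mono fun x (hx : 0 < x) y (hy : a < y) =>
      abs_mul_id_mul_le_exp hC0 hC hu.bound hv.bound₁ ha hy.le ha hy.le hx.le
  · exact ((exp_neg_integrableOn_Ioi 0 ha).const_mul a⁻¹).const_mul C
  · refine (ae_restrict_mem measurableSet_Ioi).mono fun x (hx : 0 < x) y (hy : a < y) => ?_
    have h := hasDerivAt_comp_mul_left hv.hasDerivAt hx (ha.trans hy)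
    simp only [mul_comm x] at h
    exact (h.const_mul _).congr_deriv (by ring)

theorem IsAiryProduct.integral_eq_boundary (hu : IsAiryProduct u u₁ u₂ φ)
    (hv : IsAiryProduct v v₁ v₂ ψ) (hC0 : 0 ≤ C)
    (hC : ∀ s y, 0 ≤ s → s ≤ y → φ s * ψ y ≤ C * exp (-2 * y))
    {a b : ℝ} (ha : 0 < a) (hab : a ≤ b) :
    (b ^ 3 - a ^ 3) * (4 * b * (∫ x in Set.Ioi (0 : ℝ), u (a * x) * (x * v₁ (b * x))) +
      2 * ∫ x in Set.Ioi (0 : ℝ), u (a * x) * v (b * x)) =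
    -(b ^ 2 * (u 0 * v₂ 0) - a * b * (u₁ 0 * v₁ 0) + a ^ 2 * (u₂ 0 * v 0)) := by
  have hb := ha.trans_le hab
  let Q : ℝ → ℝ := fun x => b ^ 2 * (u (a * x) * v₂ (b * x)) - a * b * (u₁ (a * x) * v₁ (b * x)) +
    a ^ 2 * (u₂ (a * x) * v (b * x)) - 4 * a ^ 3 * (u (a * x) * (x * v (b * x)))
  have i1 := hu.integrableOn_mul_id_mul hv hC0 hC ha hab
  have i2 := hu.integrableOn_mul hv hC ha hab
  have hcont : ContinuousWithinAt Q (Set.Ici 0) 0 := by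
    have c0 := continuousWithinAt_comp_mul_left hu.cont ha
    have c1 := continuousWithinAt_comp_mul_left hu.cont₁ ha
    have c2 := continuousWithinAt_comp_mul_left hu.cont₂ ha
    have d0 := continuousWithinAt_comp_mul_left hv.cont hb
    have d1 := continuousWithinAt_comp_mul_left hv.cont₁ hb
    have d2 := continuousWithinAt_comp_mul_left hv.cont₂ hb
    exact (((((c0.mul d2).const_mul _).sub ((c1.mul d1).const_mul _)).add
      ((c2.mul d0).const_mul _)).sub ((c0.mul (continuousWithinAt_id.mul d0)).const_mul _))
  have hderiv : ∀ x ∈ Set.Ioi (0 : ℝ), HasDerivAt Q ((b ^ 3 - a ^ 3) *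
      (4 * b * (u (a * x) * (x * v₁ (b * x))) + 2 * (u (a * x) * v (b * x)))) x := by
    intro x (hx : 0 < x)
    have c0 := hasDerivAt_comp_mul_left hu.hasDerivAt ha hx
    have c1 := hasDerivAt_comp_mul_left hu.hasDerivAt₁ ha hx
    have c2 := hasDerivAt_comp_mul_left hu.hasDerivAt₂ ha hx
    have d0 := hasDerivAt_comp_mul_left hv.hasDerivAt hb hx
    have d1 := hasDerivAt_comp_mul_left hv.hasDerivAt₁ hb hx
    have d2 := hasDerivAt_comp_mul_left hv.hasDerivAt₂ hb hx
    refine (((((c0.mul d2).const_mul _).sub ((c1.mul d1).const_mul _)).add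
      ((c2.mul d0).const_mul _)).sub
        ((c0.mul ((hasDerivAt_id x).mul d0)).const_mul _)).congr_deriv ?_
    simp only [id, Pi.mul_apply]
    ring
  have hlim : Filter.Tendsto Q Filter.atTop (nhds 0) := by
    have key : ∀ p q : ℝ → ℝ, (∀ x, 0 ≤ x → |p x| ≤ φ x) → (∀ x, 0 ≤ x → |q x| ≤ ψ x) →
        Filter.Tendsto (fun x => p (a * x) * q (b * x)) Filter.atTop (nhds 0) :=
      fun p q hp hq => squeeze_zero_norm' ((Filter.eventually_ge_atTop 0).mono fun x hx =>
        abs_mul_le_exp hC hp hq ha hab hx) (tendsto_exp_neg_mul_atTop (by linarith) C)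
    have l4 : Filter.Tendsto (fun x => u (a * x) * (x * v (b * x))) Filter.atTop (nhds 0) := by
      refine squeeze_zero_norm' ((Filter.eventually_ge_atTop 0).mono fun x hx =>
        abs_mul_id_mul_le_exp hC0 hC hu.bound hv.bound ha hab hb le_rfl hx) ?_
      simpa only [mul_assoc] using tendsto_exp_neg_mul_atTop hb (C * b⁻¹)
    simpa using (((((key u v₂ hu.bound hv.bound₂).const_mul (b ^ 2)).sub
      ((key u₁ v₁ hu.bound₁ hv.bound₁).const_mul (a * b))).add
      ((key u₂ v hu.bound₂ hv.bound).const_mul (a ^ 2))).sub (l4.const_mul (4 * a ^ 3)))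
  have h := integral_Ioi_of_hasDerivAt_of_tendsto hcont hderiv
    (((i1.const_mul _).add (i2.const_mul _)).const_mul _) hlim
  rw [integral_const_mul, integral_add (i1.const_mul _) (i2.const_mul _), integral_const_mul,
    integral_const_mul] at h
  rw [h]
  simp [Q]

theorem IsAiryProduct.tendsto_sqrt_mul_integral (hu : IsAiryProduct u u₁ u₂ φ)
    (hv : IsAiryProduct v v₁ v₂ ψ)
    (hC : ∀ s y, 0 ≤ s → s ≤ y → φ s * ψ y ≤ C * exp (-2 * y)) {a : ℝ} (ha : 0 < a) :
    Filter.Tendsto (fun b => √b * ∫ x in Set.Ioi (0 : ℝ), u (a * x) * v (b * x)) Filter.atTop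
      (nhds 0) := by
  have hlim : Filter.Tendsto (fun b => C / 2 * (√b)⁻¹) Filter.atTop (nhds 0) := by
    simpa using (tendsto_inv_atTop_zero.comp tendsto_sqrt_atTop).const_mul (C / 2)
  refine squeeze_zero_norm' ((Filter.eventually_ge_atTop a).mono fun b hab => ?_) hlim
  have hb := ha.trans_le hab
  have h : ‖∫ x in Set.Ioi (0 : ℝ), u (a * x) * v (b * x)‖ ≤
      ∫ x in Set.Ioi (0 : ℝ), C * exp (-(2 * b) * x) := by
    refine norm_integral_le_of_norm_le
      ((exp_neg_integrableOn_Ioi 0 (by linarith)).const_mul C) ?_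
    exact (ae_restrict_mem measurableSet_Ioi).mono fun x (hx : 0 < x) =>
      abs_mul_le_exp hC hu.bound hv.bound ha hab hx.le
  rw [integral_const_mul, integral_exp_mul_Ioi (by linarith), mul_zero, exp_zero] at h
  rw [norm_mul, norm_of_nonneg (sqrt_nonneg b)]
  refine (mul_le_mul_of_nonneg_left h (sqrt_nonneg b)).trans_eq ?_
  have hs : 0 < √b := sqrt_pos.2 hb
  have : b = √b * √b := (mul_self_sqrt hb.le).symm
  set r := √b
  rw [this]
  field_simp

end Pairing

theorem exp_growth_mul_exp_decay_le {s y : ℝ} (hs : 0 ≤ s) (hsy : s ≤ y) :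
    exp (3 * s + s * √s / 2) * exp (y - y * √y) ≤ exp 864 * exp (-2 * y) := by
  rw [← exp_add, ← exp_add]
  refine exp_le_exp.2 ?_
  have hy := hs.trans hsy
  have h1 : s * √s ≤ y * √y := by gcongr
  have h2 : 12 * y - y * √y ≤ 1728 := by
    have h := sq_sqrt hy
    have h0 := sqrt_nonneg y
    set r := √y
    rcases le_total r 12 with hr | hr <;> nlinarith
  linarith

theorem exists_isAiryProduct_ai_bi :
    ∃ u₁ u₂ v₁ v₂ φ ψ : ℝ → ℝ, ∃ C : ℝ, 0 ≤ C ∧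
      IsAiryProduct (fun x => aiExt x * biExt x) u₁ u₂ φ ∧
      IsAiryProduct (fun x => aiExt x * aiExt x) v₁ v₂ ψ ∧
      (∀ s y, 0 ≤ s → s ≤ y → φ s * ψ y ≤ C * exp (-2 * y)) ∧
      ∀ a b : ℝ, b ^ 2 * (aiExt 0 * biExt 0 * v₂ 0) - a * b * (u₁ 0 * v₁ 0) +
        a ^ 2 * (u₂ 0 * (aiExt 0 * aiExt 0)) = √3 / (6 * π ^ 2) * (b ^ 2 - a ^ 2) := by
  obtain ⟨M, hM⟩ := exists_abs_aiExt_le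
  obtain ⟨N, hN⟩ := exists_abs_biExt_le
  have hM0 : 0 ≤ M := by
    have := (abs_nonneg _).trans (hM 0 le_rfl).1
    exact nonneg_of_mul_nonneg_left this (exp_pos _)
  have hN0 : 0 ≤ N := by
    have := (abs_nonneg _).trans (hN 0 le_rfl).1
    exact nonneg_of_mul_nonneg_left this (exp_pos _)
  have hA : ∀ x, 0 < x → HasDerivAt aiExt (aiExtDeriv x) x := fun x => hasDerivAt_aiExt
  have hA₁ : ∀ x, 0 < x → HasDerivAt aiExtDeriv (x * aiExt x) x := fun x => hasDerivAt_aiExtDeriv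
  refine ⟨_, _, _, _, _, _, 4 * (M * N) * (4 * (M * M)) * exp 864, by positivity,
    isAiryProduct_mul hA hA₁ (fun x _ => hasDerivAt_biExt x) (fun x _ => hasDerivAt_biExtDeriv x)
      continuousWithinAt_aiExt continuousWithinAt_aiExtDeriv
      (hasDerivAt_biExt 0).continuousAt.continuousWithinAt
      (hasDerivAt_biExtDeriv 0).continuousAt.continuousWithinAt hM hN,
    isAiryProduct_mul hA hA₁ hA hA₁ continuousWithinAt_aiExt continuousWithinAt_aiExtDeriv
      continuousWithinAt_aiExt continuousWithinAt_aiExtDeriv hM hM, fun s y hs hsy => ?_,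
    fun a b => ?_⟩
  · have e1 : exp (-(s * √s / 2)) * exp (2 * s + s * √s) * exp s =
        exp (3 * s + s * √s / 2) := by
      rw [← exp_add, ← exp_add]
      congr 1
      ring
    have e2 : exp (-(y * √y / 2)) * exp (-(y * √y / 2)) * exp y = exp (y - y * √y) := by
      rw [← exp_add, ← exp_add]
      congr 1
      ring
    calc _ = 4 * (M * N) * (4 * (M * M)) *
          ((exp (-(s * √s / 2)) * exp (2 * s + s * √s) * exp s) *
            (exp (-(y * √y / 2)) * exp (-(y * √y / 2)) * exp y)) := by ring
      _ ≤ 4 * (M * N) * (4 * (M * M)) * (exp 864 * exp (-2 * y)) := by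
        rw [e1, e2]
        exact mul_le_mul_of_nonneg_left (exp_growth_mul_exp_decay_le hs hsy) (by positivity)
      _ = _ := by ring
  · have h := aiExt_zero_mul_aiExtDeriv_zero
    have h3 : √3 * √3 = 3 := mul_self_sqrt (by norm_num)
    have hs : (0 : ℝ) < √3 := by positivity
    have hpi := pi_pos
    rw [biExt_zero_eq, biExtDeriv_zero_eq]
    trans 2 * √3 * (aiExt 0 * aiExtDeriv 0) ^ 2 * (b ^ 2 - a ^ 2)
    · ring
    · rw [h]
      field_simp
      linear_combination (-2 * (b ^ 2 - a ^ 2)) * h3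

theorem hasDerivAt_arctan_sqrt_div {a b : ℝ} (ha : 0 < a) (hab : a < b) :
    HasDerivAt (fun b => arctan (√(3 * a * b) / (b - a)))
      (-(√3 * √a * (a + b) / (2 * √b * (a ^ 2 + a * b + b ^ 2)))) b := by
  have hb := ha.trans hab
  have hba : b - a ≠ 0 := (sub_pos.2 hab).ne'
  have hsplit : (fun b => arctan (√(3 * a * b) / (b - a))) =
      fun b => arctan (√3 * √a * √b / (b - a)) := by
    funext b
    rw [sqrt_mul (by positivity), sqrt_mul (by norm_num)]
  rw [hsplit]
  refine ((((hasDerivAt_sqrt hb.ne').const_mul (√3 * √a)).div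
    ((hasDerivAt_id b).sub_const a) hba).arctan).congr_deriv ?_
  have h3 : √3 ^ 2 = 3 := sq_sqrt (by norm_num)
  have h4 : √a ^ 2 = a := sq_sqrt ha.le
  have h5 : √b ^ 2 = b := sq_sqrt hb.le
  have hr : 0 < √b := sqrt_pos.2 hb
  have h6 : 1 + (√3 * √a * √b / (b - a)) ^ 2 = (a ^ 2 + a * b + b ^ 2) / (b - a) ^ 2 := by
    rw [div_pow, mul_pow, mul_pow, h3, h4, h5]
    field_simp
    ring
  simp only [id, Pi.div_apply]
  rw [h6]
  have h7 : 0 < a ^ 2 + a * b + b ^ 2 := by positivity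
  field_simp
  rw [h5]
  ring

theorem tendsto_arctan_sqrt_div {a : ℝ} (ha : 0 < a) :
    Filter.Tendsto (fun b => arctan (√(3 * a * b) / (b - a))) Filter.atTop (nhds 0) := by
  have h1 : Filter.Tendsto (fun b : ℝ => √b + -(a * (√b)⁻¹)) Filter.atTop Filter.atTop := by
    refine Filter.tendsto_atTop_add_right_of_le' _ (-a) tendsto_sqrt_atTop ?_
    refine (Filter.eventually_ge_atTop 1).mono fun b hb => ?_
    have : (√b)⁻¹ ≤ 1 := inv_le_one_of_one_le₀ (one_le_sqrt.2 hb)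
    nlinarith
  have h2 : Filter.Tendsto (fun b => √(3 * a * b) / (b - a)) Filter.atTop (nhds 0) := by
    have h3 := (tendsto_inv_atTop_zero.comp h1).const_mul √(3 * a)
    rw [mul_zero] at h3
    refine h3.congr' ?_
    refine (Filter.eventually_gt_atTop a).mono fun b hb => ?_
    have hb0 := ha.trans hb
    have hr : 0 < √b := sqrt_pos.2 hb0
    have e : √b + -(a * (√b)⁻¹) = (b - a) / √b := by
      have := mul_self_sqrt hb0.le
      field_simp
      linear_combination this
    simp only [Function.comp]
    rw [e, inv_div, sqrt_mul (show 0 ≤ 3 * a by positivity) b]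
    ring
  simpa [Function.comp_def] using (continuous_arctan.tendsto 0).comp h2

theorem stmt18 (a b : ℝ) (ha : 0 < a) (hab : a < b) :
    (∫ x in Set.Ioi (0:ℝ), airyBi (a * x) * airyAi (a * x) * (airyAi (b * x)) ^ 2)
    = (1 / (12 * π ^ 2 * Real.sqrt (a * b)))
      * Real.arctan (Real.sqrt (3 * a * b) / (b - a)) := by
  obtain ⟨u₁, u₂, v₁, v₂, φ, ψ, C, hC0, hu, hv, hC, hbdry⟩ := exists_isAiryProduct_ai_bi
  set F : ℝ → ℝ := fun b => ∫ x in Set.Ioi (0 : ℝ),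
    aiExt (a * x) * biExt (a * x) * (aiExt (b * x) * aiExt (b * x)) with hF
  have hb := ha.trans hab
  have hint : (∫ x in Set.Ioi (0:ℝ), airyBi (a * x) * airyAi (a * x) * (airyAi (b * x)) ^ 2) =
      F b := by
    refine setIntegral_congr_fun measurableSet_Ioi fun x (hx : 0 < x) => ?_
    simp only [airyBi_eq_biExt (mul_pos ha hx), airyAi_eq_aiExt (mul_pos ha hx),
      airyAi_eq_aiExt (mul_pos hb hx)]
    ring
  have hsa : 0 < √a := sqrt_pos.2 ha
  have hpi := pi_pos
  let H : ℝ → ℝ := fun b =>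
    √b * F b - 1 / (12 * π ^ 2 * √a) * arctan (√(3 * a * b) / (b - a))
  have hH : ∀ y, a < y → HasDerivAt H 0 y := by
    intro y hy
    have hy0 := ha.trans hy
    have hr : 0 < √y := sqrt_pos.2 hy0
    have hrr : √y ^ 2 = y := sq_sqrt hy0.le
    have h1 := hu.hasDerivAt_integral hv hC0 hC ha hy
    have h2 := hu.integral_eq_boundary hv hC0 hC ha hy.le
    rw [hbdry] at h2
    set D := ∫ x in Set.Ioi (0 : ℝ), aiExt (a * x) * biExt (a * x) * (x * v₁ (y * x))
    change (y ^ 3 - a ^ 3) * (4 * y * D + 2 * F y) = _ at h2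
    have hpos : 0 < a ^ 2 + a * y + y ^ 2 := by positivity
    have h3 : 4 * y * D + 2 * F y =
        -(√3 / (6 * π ^ 2) * (a + y) / (a ^ 2 + a * y + y ^ 2)) := by
      have hne : y - a ≠ 0 := (sub_pos.2 hy).ne'
      rw [← neg_div, eq_div_iff hpos.ne']
      refine mul_left_cancel₀ hne ?_
      linear_combination h2
    refine (((hasDerivAt_sqrt hy0.ne').mul h1).sub
      ((hasDerivAt_arctan_sqrt_div ha hy).const_mul _)).congr_deriv ?_
    change 1 / (2 * √y) * F y + √y * D - _ = 0
    have h4 : 1 / (2 * √y) * F y + √y * D = (4 * y * D + 2 * F y) / (4 * √y) := by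
      field_simp
      rw [hrr]
      ring
    rw [h4, h3]
    field_simp
    ring
  have hlim : Filter.Tendsto H Filter.atTop (nhds 0) := by
    simpa using (hu.tendsto_sqrt_mul_integral hv hC ha).sub
      ((tendsto_arctan_sqrt_div ha).const_mul (1 / (12 * π ^ 2 * √a)))
  have hzero : H b = 0 := by
    refine tendsto_nhds_unique (tendsto_const_nhds.congr' ?_) hlim
    refine (Filter.eventually_gt_atTop a).mono fun y hy => ?_
    exact isOpen_Ioi.is_const_of_deriv_eq_zero (convex_Ioi a).isPreconnected
      (fun z hz => (hH z hz).differentiableAt.differentiableWithinAt)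
      (fun z hz => (hH z hz).deriv) hab hy
  have hsb : 0 < √b := sqrt_pos.2 hb
  rw [hint, sqrt_mul ha.le]
  simp only [H] at hzero
  refine mul_left_cancel₀ hsb.ne' ?_
  rw [sub_eq_zero.1 hzero]
  field_simp
end

section
/- Let z be a real number with 0 < z < 1. Then 5 · ₂F₁(1/6, 1; 7/6; z) − z^{2/3} · ₂F₁(5/6, 1; 11/6; z) = (5/(√3 · z^{1/6})) · arctan( √3 · z^{1/6} / (1 − z^{1/3}) ). -/
open MeasureTheory Real

noncomputable def poch (u : ℝ) (k : ℕ) : ℝ := ∏ i ∈ Finset.range k, (u + (i : ℝ))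
noncomputable def hyp2F1 (a b c z : ℝ) : ℝ :=
  ∑' k : ℕ, (poch a k * poch b k / poch c k) * z ^ k / (k.factorial : ℝ)

theorem poch_pos {u : ℝ} (hu : 0 < u) (k : ℕ) : 0 < poch u k :=
  Finset.prod_pos fun i _ => by positivity

theorem poch_one (k : ℕ) : poch 1 k = k.factorial := by
  induction k with
  | zero => simp [poch]
  | succ k ih =>
    rw [poch, Finset.prod_range_succ, ← poch, ih, Nat.factorial_succ]
    push_cast
    ring

theorem mul_poch_add_one (u : ℝ) (k : ℕ) : u * poch (u + 1) k = poch u k * (u + k) := by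
  rw [poch, poch, ← Finset.prod_range_succ, Finset.prod_range_succ']
  rw [mul_comm]
  congr 1
  · refine Finset.prod_congr rfl fun i _ => ?_
    push_cast
    ring
  · simp

theorem hyp2F1_one_add_one {a : ℝ} (ha : 0 < a) (z : ℝ) :
    hyp2F1 a 1 (a + 1) z = ∑' k : ℕ, a * z ^ k / (a + k) := by
  refine tsum_congr fun k => ?_
  have h := mul_poch_add_one a k
  have h1 := poch_pos (by positivity : 0 < a + 1) k
  have h2 : 0 < a + k := by positivity
  rw [poch_one]
  field_simp
  linear_combination -z ^ k * h

theorem summable_mul_pow_div_add {a z : ℝ} (ha : 0 < a) (hz0 : 0 < z) (hz1 : z < 1) :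
    Summable fun k : ℕ => a * z ^ k / (a + k) := by
  refine Summable.of_nonneg_of_le (fun k => by positivity) (fun k => ?_)
    (summable_geometric_of_lt_one hz0.le hz1)
  rw [div_le_iff₀ (by positivity)]
  nlinarith [mul_nonneg (pow_nonneg hz0.le k) k.cast_nonneg]

theorem hasDerivAt_arctan_sqrt_three {t : ℝ} (ht : 1 - t ^ 2 ≠ 0) :
    HasDerivAt (fun t => arctan (√3 * t / (1 - t ^ 2)) / √3)
      ((1 + t ^ 2) / (1 + t ^ 2 + t ^ 4)) t := by
  have h1 : HasDerivAt (fun t : ℝ => √3 * t) √3 t := by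
    simpa using (hasDerivAt_id t).const_mul √3
  have h2 : HasDerivAt (fun t : ℝ => 1 - t ^ 2) (-(2 * t)) t := by
    simpa using (hasDerivAt_pow 2 t).const_sub 1
  refine (((h1.fun_div h2 ht).arctan).div_const √3).congr_deriv ?_
  have h3 : √3 ^ 2 = 3 := Real.sq_sqrt (by norm_num)
  have h4 : 1 + t ^ 2 + t ^ 4 ≠ 0 := by positivity
  have h5 : 1 + (√3 * t / (1 - t ^ 2)) ^ 2 = (1 + t ^ 2 + t ^ 4) / (1 - t ^ 2) ^ 2 := by
    rw [div_pow, mul_pow, h3]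
    field_simp
    ring
  rw [h5]
  have h6 : √3 ≠ 0 := by positivity
  field_simp
  ring

theorem abs_arctan_sub_sum_le {x : ℝ} (hx0 : 0 < x) (hx1 : x < 1) (N : ℕ) :
    |arctan (√3 * x / (1 - x ^ 2)) / √3 -
      ∑ k ∈ Finset.range N, (x ^ (6 * k + 1) / (6 * k + 1) - x ^ (6 * k + 5) / (6 * k + 5))|
      ≤ (x ^ 6) ^ N * x := by
  have hS (t : ℝ) : HasDerivAt (fun t : ℝ => ∑ k ∈ Finset.range N,
      (t ^ (6 * k + 1) / (6 * k + 1) - t ^ (6 * k + 5) / (6 * k + 5)))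
      (∑ k ∈ Finset.range N, (1 - t ^ 4) * (t ^ 6) ^ k) t := by
    refine HasDerivAt.fun_sum fun k _ => ?_
    refine (((hasDerivAt_pow (6 * k + 1) t).div_const (6 * k + 1 : ℝ)).fun_sub
      ((hasDerivAt_pow (6 * k + 5) t).div_const (6 * k + 5 : ℝ))).congr_deriv ?_
    have h1 : (6 * k + 1 : ℝ) ≠ 0 := by positivity
    have h2 : (6 * k + 5 : ℝ) ≠ 0 := by positivity
    simp only [Nat.add_sub_cancel, show 6 * k + 5 - 1 = 6 * k + 4 by omega]
    push_cast
    field_simp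
    ring
  have hlt {t : ℝ} (ht : t ∈ Set.Icc 0 x) : 0 < 1 - t ^ 2 := by
    nlinarith [ht.1, ht.2]
  have key := (convex_Icc (0 : ℝ) x).norm_image_sub_le_of_norm_hasDerivWithin_le
    (C := (x ^ 6) ^ N)
    (fun t ht => ((hasDerivAt_arctan_sqrt_three (hlt ht).ne').fun_sub (hS t)).hasDerivWithinAt)
    (fun t ht => ?_) (Set.left_mem_Icc.2 hx0.le) (Set.right_mem_Icc.2 hx0.le)
  · simpa [abs_of_pos hx0] using key
  · have hg := mul_neg_geom_sum (t ^ 6) N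
    have hq : 0 < 1 + t ^ 2 + t ^ 4 := by positivity
    have hd : (1 + t ^ 2) / (1 + t ^ 2 + t ^ 4) -
        ∑ k ∈ Finset.range N, (1 - t ^ 4) * (t ^ 6) ^ k
        = (1 + t ^ 2) / (1 + t ^ 2 + t ^ 4) * (t ^ 6) ^ N := by
      rw [← Finset.mul_sum]
      have h := hlt ht
      field_simp
      linear_combination (-(1 + t ^ 2)) * hg
    rw [hd, Real.norm_of_nonneg (by positivity)]
    have h1 : (1 + t ^ 2) / (1 + t ^ 2 + t ^ 4) ≤ 1 := by
      rw [div_le_one hq]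
      nlinarith [sq_nonneg (t ^ 2)]
    have h2 : (t ^ 6) ^ N ≤ (x ^ 6) ^ N := by
      have := ht.1
      have := ht.2
      gcongr
    calc _ ≤ 1 * (t ^ 6) ^ N := by gcongr
      _ ≤ _ := by simpa using h2

theorem tendsto_sum_arctan {x : ℝ} (hx0 : 0 < x) (hx1 : x < 1) :
    Filter.Tendsto (fun N => ∑ k ∈ Finset.range N,
      (x ^ (6 * k + 1) / (6 * k + 1) - x ^ (6 * k + 5) / (6 * k + 5)))
      Filter.atTop (nhds (arctan (√3 * x / (1 - x ^ 2)) / √3)) := by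
  rw [tendsto_iff_dist_tendsto_zero]
  refine squeeze_zero (fun _ => dist_nonneg) (fun N => ?_) (g := fun N => (x ^ 6) ^ N * x) ?_
  · rw [dist_comm, Real.dist_eq]
    exact abs_arctan_sub_sum_le hx0 hx1 N
  · simpa using (tendsto_pow_atTop_nhds_zero_of_lt_one (by positivity)
      (pow_lt_one₀ hx0.le hx1 (by norm_num : 6 ≠ 0))).mul_const x

theorem stmt19 (z : ℝ) (hz0 : 0 < z) (hz1 : z < 1) :
    5 * hyp2F1 (1 / 6) 1 (7 / 6) z - z ^ ((2 : ℝ) / 3) * hyp2F1 (5 / 6) 1 (11 / 6) z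
    = (5 / (Real.sqrt 3 * z ^ ((1 : ℝ) / 6)))
      * Real.arctan (Real.sqrt 3 * z ^ ((1 : ℝ) / 6) / (1 - z ^ ((1 : ℝ) / 3))) := by
  obtain ⟨x, hx⟩ : ∃ x, x = z ^ ((1 : ℝ) / 6) := ⟨_, rfl⟩
  have hx0 : 0 < x := hx ▸ rpow_pos_of_pos hz0 _
  have hx1 : x < 1 := hx ▸ rpow_lt_one hz0.le hz1 (by norm_num)
  have hx2 : z ^ ((1 : ℝ) / 3) = x ^ 2 := by
    rw [hx, ← rpow_mul_natCast hz0.le]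
    norm_num
  have hx4 : z ^ ((2 : ℝ) / 3) = x ^ 4 := by
    rw [hx, ← rpow_mul_natCast hz0.le]
    norm_num
  have hx6 : z = x ^ 6 := by
    rw [hx, ← rpow_mul_natCast hz0.le]
    norm_num
  have e1 := hyp2F1_one_add_one (a := 1 / 6) (by norm_num) z
  have e2 := hyp2F1_one_add_one (a := 5 / 6) (by norm_num) z
  norm_num only at e1 e2
  have s1 := (summable_mul_pow_div_add (a := 1 / 6) (by norm_num) hz0 hz1).hasSum.mul_left 5
  have s2 := (summable_mul_pow_div_add (a := 5 / 6) (by norm_num) hz0 hz1).hasSum.mul_left (x ^ 4)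
  have hs := (((s1.sub s2).mul_left (x / 5))).tendsto_sum_nat
  rw [hx2, hx4, ← hx, e1, e2]
  have hu := tendsto_nhds_unique (hs.congr fun N => Finset.sum_congr rfl fun k _ => ?_)
    (tendsto_sum_arctan hx0 hx1)
  · have h6 : √3 ≠ 0 := by positivity
    field_simp at hu ⊢
    linarith
  · rw [hx6]
    have h1 : (6 * k + 1 : ℝ) ≠ 0 := by positivity
    have h2 : (6 * k + 5 : ℝ) ≠ 0 := by positivity
    rw [show (1 / 6 + k : ℝ) = (6 * k + 1) / 6 by ring,
      show (5 / 6 + k : ℝ) = (6 * k + 5) / 6 by ring]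
    field_simp
    ring
end
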